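/- Let S be a weakly subsemigroup separable semigroup and let T be a residually finite periodic semigroup. Then the direct product S × T is monogenic subsemigroup separable. -/

import Mathlib

/-- `s` can be separated from `Y` in `S`: there is a homomorphism to a finite
semigroup mapping `s` outside the image of `Y`. -/
def Separates {S : Type*} [Semigroup S] (s : S) (Y : Set S) : Prop :=
  ∃ (P : Type) (_ : Semigroup P) (_ : Finite P) (φ : S →ₙ* P), φ s ∉ φ '' Y

/-- Complete separability. -/
def IsCS (S : Type*) [Semigroup S] : Prop :=
  ∀ (s : S) (Y : Set S), s ∉ Y → Separates s Y

/-- Strong subsemigroup separability. -/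
def IsSSS (S : Type*) [Semigroup S] : Prop :=
  ∀ (s : S) (Y : Subsemigroup S), s ∉ Y → Separates s (Y : Set S)

/-- Weak subsemigroup separability. -/
def IsWSS (S : Type*) [Semigroup S] : Prop :=
  ∀ (s : S) (X : Finset S), s ∉ Subsemigroup.closure (X : Set S) →
    Separates s (Subsemigroup.closure (X : Set S) : Set S)

/-- Monogenic subsemigroup separability. -/
def IsMSS (S : Type*) [Semigroup S] : Prop :=
  ∀ (s x : S), s ∉ Subsemigroup.closure {x} →
    Separates s (Subsemigroup.closure {x} : Set S)

/-- Residual finiteness. -/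
def ResiduallyFinite (S : Type*) [Semigroup S] : Prop :=
  ∀ s t : S, s ≠ t → ∃ (P : Type) (_ : Semigroup P) (_ : Finite P) (φ : S →ₙ* P), φ s ≠ φ t

namespace Separates

variable {S : Type*} [Semigroup S]

theorem mono {s : S} {Y Z : Set S} (h : Separates s Z) (hYZ : Y ⊆ Z) : Separates s Y := by
  obtain ⟨P, i, f, φ, hφ⟩ := h
  exact ⟨P, i, f, φ, fun hs => hφ (Set.image_mono hYZ hs)⟩

theorem union {s : S} {Y Z : Set S} (hY : Separates s Y) (hZ : Separates s Z) :
    Separates s (Y ∪ Z) := by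
  obtain ⟨P, _, _, φ, hφ⟩ := hY
  obtain ⟨Q, _, _, ψ, hψ⟩ := hZ
  refine ⟨P × Q, inferInstance, inferInstance, φ.prod ψ, ?_⟩
  rintro ⟨z, hz | hz, h⟩
  · exact hφ ⟨z, hz, congrArg Prod.fst h⟩
  · exact hψ ⟨z, hz, congrArg Prod.snd h⟩

theorem empty (s : S) : Separates s ∅ :=
  ⟨PUnit, inferInstance, inferInstance, ⟨fun _ => PUnit.unit, fun _ _ => rfl⟩, by simp⟩

end Separates

theorem ResiduallyFinite.separates_of_finite {S : Type*} [Semigroup S] (hS : ResiduallyFinite S)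
    {s : S} {Y : Set S} (hY : Y.Finite) (hs : s ∉ Y) : Separates s Y := by
  induction Y, hY using Set.Finite.induction_on with
  | empty => exact Separates.empty s
  | @insert y Y _ _ ih =>
    rw [Set.mem_insert_iff, not_or] at hs
    obtain ⟨P, i, f, φ, hφ⟩ := hS s y hs.1
    refine Separates.union (Y := {y}) ⟨P, i, f, φ, ?_⟩ (ih hs.2)
    simpa [eq_comm] using hφ

/-- The power `x ^ (n + 1)` in a semigroup. -/
def succPow {S : Type*} [Semigroup S] (x : S) : ℕ → S
  | 0 => x
  | n + 1 => succPow x n * x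

section SuccPow

variable {S : Type*} [Semigroup S]

theorem succPow_mul (x : S) (m n : ℕ) :
    succPow x m * succPow x n = succPow x (m + n + 1) := by
  induction n with
  | zero => rfl
  | succ n ih =>
    change succPow x m * (succPow x n * x) = succPow x (m + n + 1) * x
    rw [← mul_assoc, ih]

theorem succPow_succPow (x : S) (m n : ℕ) :
    succPow (succPow x m) n = succPow x (m * n + m + n) := by
  induction n with
  | zero => simp [succPow]
  | succ n ih =>
    change succPow (succPow x m) n * succPow x m = _
    rw [ih, succPow_mul]
    congr 1
    ring

theorem mem_closure_singleton_iff_succPow {x z : S} :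
    z ∈ Subsemigroup.closure {x} ↔ ∃ n, succPow x n = z := by
  constructor
  · intro h
    induction h using Subsemigroup.closure_induction with
    | mem y hy => exact ⟨0, (Set.mem_singleton_iff.1 hy).symm⟩
    | mul a b _ _ iha ihb =>
      obtain ⟨m, rfl⟩ := iha
      obtain ⟨n, rfl⟩ := ihb
      exact ⟨_, (succPow_mul x m n).symm⟩
  · rintro ⟨n, rfl⟩
    induction n with
    | zero => exact Subsemigroup.subset_closure rfl
    | succ n ih => exact mul_mem ih (Subsemigroup.subset_closure rfl)

theorem exists_finset_mem_closure_iff_succPow (x : S) (a : ℕ) :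
    ∃ X : Finset S, ∀ z, z ∈ Subsemigroup.closure (X : Set S) ↔ ∃ n, a < n ∧ succPow x n = z := by
  classical
  refine ⟨(Finset.Icc (a + 1) (2 * a + 2)).image (succPow x), fun z => ⟨fun h => ?_, ?_⟩⟩
  · induction h using Subsemigroup.closure_induction with
    | mem y hy =>
      obtain ⟨n, hn, rfl⟩ := Finset.mem_image.1 (Finset.mem_coe.1 hy)
      exact ⟨n, (Finset.mem_Icc.1 hn).1, rfl⟩
    | mul u v _ _ ihu ihv =>
      obtain ⟨m, hm, rfl⟩ := ihu
      obtain ⟨n, hn, rfl⟩ := ihv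
      exact ⟨_, by omega, (succPow_mul x m n).symm⟩
  · rintro ⟨n, hn, rfl⟩
    have gen : ∀ k, a < k → k ≤ 2 * a + 2 → succPow x k ∈ Subsemigroup.closure
        (((Finset.Icc (a + 1) (2 * a + 2)).image (succPow x) : Finset S) : Set S) :=
      fun k h₁ h₂ => Subsemigroup.subset_closure
        (Finset.mem_coe.2 (Finset.mem_image_of_mem _ (Finset.mem_Icc.2 ⟨h₁, h₂⟩)))
    induction n using Nat.strong_induction_on with
    | _ n ih =>
      by_cases h : n ≤ 2 * a + 2
      · exact gen n hn h
      · have key := mul_mem (ih (n - (a + 2)) (by omega) (by omega))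
          (gen (a + 1) (by omega) (by omega))
        rwa [succPow_mul, show n - (a + 2) + (a + 1) + 1 = n by omega] at key

theorem finite_closure_singleton_of_succPow_eq {x : S} {a b : ℕ} (hab : a < b)
    (h : succPow x a = succPow x b) : (Subsemigroup.closure {x} : Set S).Finite := by
  refine ((Set.finite_Iio b).image (succPow x)).subset fun z hz => ?_
  obtain ⟨n, rfl⟩ := mem_closure_singleton_iff_succPow.1 hz
  clear hz
  induction n using Nat.strong_induction_on with
  | _ n ih =>
    rcases lt_trichotomy n b with hn | rfl | hn
    · exact ⟨n, hn, rfl⟩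
    · exact ⟨a, hab, h⟩
    · have key : succPow x n = succPow x (a + (n - b - 1) + 1) := by
        rw [← succPow_mul, h, succPow_mul]
        congr 1
        omega
      rw [key]
      exact ih _ (by omega)

end SuccPow

section Separability

variable {S : Type*} [Semigroup S]

theorem IsWSS.isMSS (hS : IsWSS S) : IsMSS S := fun s x h => by
  simpa using hS s {x} (by simpa using h)

theorem IsMSS.residuallyFinite (hS : IsMSS S) : ResiduallyFinite S := by
  intro s t hst
  by_cases hs : s ∈ Subsemigroup.closure {t}
  swap
  · obtain ⟨P, i, f, φ, hφ⟩ := hS s t hs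
    exact ⟨P, i, f, φ, fun h => hφ ⟨t, Subsemigroup.subset_closure rfl, h.symm⟩⟩
  by_cases ht : t ∈ Subsemigroup.closure {s}
  swap
  · obtain ⟨P, i, f, φ, hφ⟩ := hS t s ht
    exact ⟨P, i, f, φ, fun h => hφ ⟨s, Subsemigroup.subset_closure rfl, h⟩⟩
  -- Here `s` and `t` generate the same finite cyclic group, with identity `e`, and it suffices
  -- to separate `s * t⁻¹` from `e`.
  obtain ⟨n, rfl⟩ := mem_closure_singleton_iff_succPow.1 hs
  obtain ⟨m, hm⟩ := mem_closure_singleton_iff_succPow.1 ht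
  have hn0 : n ≠ 0 := by rintro rfl; exact hst rfl
  have hm0 : m ≠ 0 := by rintro rfl; exact hst hm
  rw [succPow_succPow] at hm
  obtain ⟨M, hM⟩ : ∃ M, n * m + n + m = M + 2 := ⟨n * m + n + m - 2, by omega⟩
  rw [hM] at hm
  have shift : ∀ k, succPow t (k + (M + 2)) = succPow t k := by
    intro k
    cases k with
    | zero => rw [zero_add]; exact hm
    | succ k =>
      have := succPow_mul t k (M + 2)
      rw [hm] at this
      rw [show k + 1 + (M + 2) = k + (M + 2) + 1 by omega, ← this]
      rfl
  have idem : ∀ j, succPow (succPow t (M + 1)) j = succPow t (M + 1) := by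
    intro j
    induction j with
    | zero => rfl
    | succ j ih =>
      change succPow (succPow t (M + 1)) j * succPow t (M + 1) = _
      rw [ih, succPow_mul, ← shift (M + 1)]
      rfl
  have hd : succPow t n * succPow t M ∉ Subsemigroup.closure {succPow t (M + 1)} := by
    rw [mem_closure_singleton_iff_succPow]
    rintro ⟨j, hj⟩
    rw [idem, succPow_mul] at hj
    apply hst
    rw [← shift n]
    change succPow t (n + M + 1) * t = t
    rw [← hj]
    exact hm
  obtain ⟨P, i, f, φ, hφ⟩ := hS _ _ hd
  refine ⟨P, i, f, φ, fun h => hφ ⟨_, Subsemigroup.subset_closure rfl, ?_⟩⟩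
  rw [map_mul, h, ← map_mul]
  have := succPow_mul t 0 M
  rw [zero_add] at this
  rw [← this]
  rfl

/-- In a weakly subsemigroup separable semigroup, any element can be separated from the other
elements of a monogenic subsemigroup. -/
theorem IsWSS.separates_closure_singleton_sdiff (hS : IsWSS S) (s x : S) :
    Separates s ((Subsemigroup.closure {x} : Set S) \ {s}) := by
  have hR := hS.isMSS.residuallyFinite
  by_cases hs : s ∈ Subsemigroup.closure {x}
  swap
  · exact (hS.isMSS s x hs).mono Set.sdiff_subset
  obtain ⟨a, rfl⟩ := mem_closure_singleton_iff_succPow.1 hs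
  obtain ⟨X, hX⟩ := exists_finset_mem_closure_iff_succPow x a
  by_cases hmem : succPow x a ∈ Subsemigroup.closure (X : Set S)
  · obtain ⟨b, hab, hb⟩ := (hX _).1 hmem
    exact hR.separates_of_finite
      ((finite_closure_singleton_of_succPow_eq hab hb.symm).subset Set.sdiff_subset) (by simp)
  · refine ((hS _ X hmem).union (hR.separates_of_finite
      (Y := (succPow x '' Set.Iio a) \ {succPow x a})
      (((Set.finite_Iio a).image _).subset Set.sdiff_subset) (by simp))).mono ?_
    rintro z ⟨hz, hne⟩
    obtain ⟨n, rfl⟩ := mem_closure_singleton_iff_succPow.1 hz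
    rcases lt_trichotomy n a with hn | rfl | hn
    · exact Or.inr ⟨⟨n, hn, rfl⟩, hne⟩
    · exact absurd rfl hne
    · exact Or.inl ((hX _).2 ⟨n, hn, rfl⟩)

end Separability

/-- The direct product of a weakly subsemigroup separable semigroup with a
residually finite periodic semigroup is monogenic subsemigroup separable. -/
theorem stmt_19 (S T : Type*) [Semigroup S] [Semigroup T]
    (hS : IsWSS S) (hT : ResiduallyFinite T)
    (hper : ∀ t : T, (Subsemigroup.closure {t} : Set T).Finite) :
    IsMSS (S × T) := by
  rintro ⟨s, t⟩ ⟨x, y⟩ hst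
  obtain ⟨P, _, _, φ, hφ⟩ := hS.separates_closure_singleton_sdiff s x
  obtain ⟨Q, _, _, ψ, hψ⟩ := hT.separates_of_finite (s := t)
    (Y := (Subsemigroup.closure {y} : Set T) \ {t}) ((hper y).subset Set.sdiff_subset) (by simp)
  refine ⟨P × Q, inferInstance, inferInstance, φ.prodMap ψ, ?_⟩
  rintro ⟨⟨u, v⟩, huv, h⟩
  have hu : u ∈ Subsemigroup.closure {x} := by
    have := Subsemigroup.mem_map_of_mem (MulHom.fst S T) huv
    rwa [MulHom.map_mclosure, Set.image_singleton] at this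
  have hv : v ∈ Subsemigroup.closure {y} := by
    have := Subsemigroup.mem_map_of_mem (MulHom.snd S T) huv
    rwa [MulHom.map_mclosure, Set.image_singleton] at this
  have hus : u = s := by
    by_contra hne
    exact hφ ⟨u, ⟨hu, hne⟩, congrArg Prod.fst h⟩
  have hvt : v = t := by
    by_contra hne
    exact hψ ⟨v, ⟨hv, hne⟩, congrArg Prod.snd h⟩
  subst hus hvt
  exact hst huv
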